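/- liminf over n → ∞ of (f(n) − n)/√n is at least √(12/5), where f(n) denotes the maximum number of edges in a simple graph on n vertices in which no two distinct cycles have the same length. -/

import Mathlib

/-- A simple graph has the property that any two distinct cycles (as subgraphs,
identified with their edge sets) have different lengths. -/
def DistinctCycleLengths {V : Type*} (G : SimpleGraph V) : Prop :=
  ∀ ⦃u v : V⦄ (c₁ : G.Walk u u) (c₂ : G.Walk v v),
    c₁.IsCycle → c₂.IsCycle → c₁.length = c₂.length →
    {e | e ∈ c₁.edges} = {e | e ∈ c₂.edges}

/-- `maxEdges n` is the maximum number of edges in a simple graph on `n` vertices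
in which no two distinct cycles have the same length. -/
noncomputable def maxEdges (n : ℕ) : ℕ :=
  sSup {m : ℕ | ∃ G : SimpleGraph (Fin n), DistinctCycleLengths G ∧ G.edgeSet.ncard = m}

theorem Finset.card_mul_succ_le_two_mul_sum_of_pos (s : Finset ℕ) (hs : ∀ x ∈ s, 0 < x) :
    s.card * (s.card + 1) ≤ 2 * ∑ x ∈ s, x := by
  induction s using Finset.induction_on_max with
  | empty => simp
  | insert a s ha ih =>
    have hnot : a ∉ s := fun h => lt_irrefl _ (ha a h)
    have hcard : s.card + 1 ≤ a := by
      have hsub : s ⊆ Finset.Ioo 0 a := fun x hx =>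
        Finset.mem_Ioo.2 ⟨hs x (Finset.mem_insert_of_mem hx), ha x hx⟩
      have h1 := Finset.card_le_card hsub
      have h2 := hs a (Finset.mem_insert_self a s)
      rw [Nat.card_Ioo] at h1
      omega
    have := ih fun x hx => hs x (Finset.mem_insert_of_mem hx)
    rw [Finset.card_insert_of_notMem hnot, Finset.sum_insert hnot]
    nlinarith

theorem Finset.exists_partial_hitting_set {E : Type*} [DecidableEq E] (S : Finset E)
    (𝓕 : Finset (Finset E)) (hne : ∀ A ∈ 𝓕, A.Nonempty) (hS : ∀ A ∈ 𝓕, A ⊆ S)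
    (hinj : Set.InjOn Finset.card (𝓕 : Set (Finset E))) (t : ℕ) :
    ∃ C ⊆ S, C.card ≤ t ∧ (𝓕.filter (Disjoint C)).card * t ≤ 2 * S.card := by
  induction t with
  | zero => exact ⟨∅, by simp, by simp, by simp⟩
  | succ t ih =>
    obtain ⟨C, hCS, hCt, hC⟩ := ih
    set U := 𝓕.filter (Disjoint C) with hU
    rcases U.eq_empty_or_nonempty with hU0 | ⟨A₀, hA₀⟩
    · exact ⟨C, hCS, by omega, by simp [← hU, hU0]⟩
    have hUF : U ⊆ 𝓕 := Finset.filter_subset _ _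
    have hSne : S.Nonempty := (hne _ (hUF hA₀)).mono (hS _ (hUF hA₀))
    obtain ⟨v, hvS, hv⟩ := Finset.exists_max_image S (fun v => (U.filter (v ∈ ·)).card) hSne
    refine ⟨insert v C, Finset.insert_subset hvS hCS,
      (Finset.card_insert_le _ _).trans (by omega), ?_⟩
    have hsum : U.card * (U.card + 1) ≤ 2 * (S.card * (U.filter (v ∈ ·)).card) := by
      have h1 := Finset.sum_card_inter_le (B := U) (s := S) hv
      have h2 : ∑ A ∈ U, (S ∩ A).card = ∑ x ∈ U.image Finset.card, x := by
        rw [Finset.sum_image (hinj.mono (by exact_mod_cast hUF))]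
        exact Finset.sum_congr rfl fun A hA => by
          rw [Finset.inter_eq_right.2 (hS A (hUF hA))]
      have h3 := Finset.card_mul_succ_le_two_mul_sum_of_pos (U.image Finset.card) (by
        intro x hx
        obtain ⟨A, hA, rfl⟩ := Finset.mem_image.1 hx
        exact (hne A (hUF hA)).card_pos)
      rw [Finset.card_image_of_injOn (hinj.mono (by exact_mod_cast hUF))] at h3
      omega
    have hsplit : (𝓕.filter (Disjoint (insert v C))).card + (U.filter (v ∈ ·)).card = U.card := by
      rw [← Finset.card_filter_add_card_filter_not (s := U) (p := (v ∈ ·)), add_comm]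
      congr 2
      ext A
      simp only [hU, Finset.mem_filter, Finset.disjoint_insert_left]
      tauto
    generalize (𝓕.filter (Disjoint (insert v C))).card = m' at *
    generalize (U.filter (v ∈ ·)).card = d at *
    generalize U.card = m at *
    generalize hN : S.card = N at *
    have hNpos : 0 < N := hN ▸ hSne.card_pos
    clear hv
    obtain ⟨s, hs⟩ := Nat.exists_eq_add_of_le hC
    have ht : t = 0 ∨ 1 ≤ t := by omega
    zify at *
    have h1 : 2 * N * m' + m * m ≤ 2 * N * (m : ℤ) := by nlinarith
    rcases ht with ht | ht
    · rw [ht]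
      nlinarith [sq_nonneg ((m : ℤ) - N)]
    · have h2 : (2 * N * m' + m * m) * (t + 1) ≤ 2 * N * m * ((t : ℤ) + 1) :=
        mul_le_mul_of_nonneg_right h1 (by positivity)
      have h3 : 0 ≤ (m : ℤ) * s * (t - 1) := by
        have : (0 : ℤ) ≤ t - 1 := by omega
        positivity
      have h4 : (2 * N : ℤ) * (m' * (t + 1)) ≤ 2 * N * (2 * N) := by
        have : (2 * N : ℤ) * (2 * N) = (m * t + s) * (m * t + s) := by rw [hs]
        have h5 : (2 * N : ℤ) * m = (m * t + s) * m := by rw [hs]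
        nlinarith [sq_nonneg (m : ℤ), sq_nonneg (s : ℤ)]
      exact le_of_mul_le_mul_left h4 (by positivity)

theorem Finset.exists_hitting_set {E : Type*} [DecidableEq E] (S : Finset E)
    (𝓕 : Finset (Finset E)) (hne : ∀ A ∈ 𝓕, A.Nonempty) (hS : ∀ A ∈ 𝓕, A ⊆ S)
    (hinj : Set.InjOn Finset.card (𝓕 : Set (Finset E))) (t : ℕ) :
    ∃ C ⊆ S, C.card * t ≤ t * t + 2 * S.card ∧ ∀ A ∈ 𝓕, ¬ Disjoint C A := by
  obtain ⟨C, hCS, hCt, hC⟩ := S.exists_partial_hitting_set 𝓕 hne hS hinj t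
  rcases isEmpty_or_nonempty E with hE | hE
  · exact ⟨∅, by simp, by simp, fun A hA => (hE.false (hne A hA).choose).elim⟩
  choose! g hg using hne
  refine ⟨C ∪ (𝓕.filter (Disjoint C)).image g, ?_, ?_, ?_⟩
  · apply Finset.union_subset hCS
    intro x hx
    obtain ⟨A, hA, rfl⟩ := Finset.mem_image.1 hx
    have hA' := (Finset.mem_filter.1 hA).1
    exact hS A hA' (hg A hA')
  · have h1 := Finset.card_union_le C ((𝓕.filter (Disjoint C)).image g)
    have h2 := Finset.card_image_le (s := 𝓕.filter (Disjoint C)) (f := g)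
    nlinarith
  · intro A hA hd
    rw [Finset.disjoint_union_left] at hd
    have : g A ∈ (𝓕.filter (Disjoint C)).image g :=
      Finset.mem_image_of_mem g (Finset.mem_filter.2 ⟨hA, hd.1⟩)
    exact Finset.disjoint_left.1 hd.2 this (hg A hA)

namespace SimpleGraph

theorem IsAcyclic.card_edgeFinset_le {V : Type*} [Fintype V] [Nonempty V] {G : SimpleGraph V}
    [Fintype G.edgeSet] (hG : G.IsAcyclic) : G.edgeFinset.card ≤ Fintype.card V := by
  classical
  obtain ⟨F, hGF, -, hF⟩ := connected_top.exists_isTree_le_of_le_of_isAcyclic le_top hG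
  have h1 := hF.card_edgeFinset
  have h2 := Finset.card_le_card (edgeFinset_mono hGF)
  omega

end SimpleGraph

theorem DistinctCycleLengths.card_edgeFinset_mul_le {V : Type*} [Fintype V] [Nonempty V]
    {G : SimpleGraph V} [Fintype G.edgeSet] (hG : DistinctCycleLengths G) (t : ℕ) :
    G.edgeFinset.card * t ≤ Fintype.card V * t + t * t + 2 * G.edgeFinset.card := by
  classical
  let 𝓕 : Finset (Finset (Sym2 V)) := G.edgeFinset.powerset.filter fun A =>
    ∃ (u : V) (c : G.Walk u u), c.IsCycle ∧ c.edges.toFinset = A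
  have hcard : ∀ {u : V} {c : G.Walk u u}, c.IsCycle → c.edges.toFinset.card = c.length :=
    fun {u c} hc => by
      rw [List.toFinset_card_of_nodup hc.edges_nodup, c.length_edges]
  obtain ⟨C, hCG, hCt, hC⟩ := G.edgeFinset.exists_hitting_set 𝓕 (by
      intro A hA
      obtain ⟨-, u, c, hc, rfl⟩ := Finset.mem_filter.1 hA
      rw [← Finset.card_pos, hcard hc]
      have := hc.three_le_length
      omega) (fun A hA => Finset.mem_powerset.1 (Finset.mem_filter.1 hA).1) (by
      intro A hA B hB hAB
      obtain ⟨-, u, c, hc, rfl⟩ := Finset.mem_filter.1 hA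
      obtain ⟨-, v, d, hd, rfl⟩ := Finset.mem_filter.1 hB
      rw [hcard hc, hcard hd] at hAB
      have h := hG c d hc hd hAB
      ext e
      simpa using Set.ext_iff.1 h e) t
  have hac : (G.deleteEdges (C : Set (Sym2 V))).IsAcyclic := by
    intro u c hc
    have hle : G.deleteEdges (C : Set (Sym2 V)) ≤ G := G.deleteEdges_le _
    have hmem : (c.mapLe hle).edges.toFinset ∈ 𝓕 := by
      refine Finset.mem_filter.2 ⟨Finset.mem_powerset.2 fun e he => ?_, u, c.mapLe hle,
        (SimpleGraph.Walk.isCycle_mapLe hle).2 hc, rfl⟩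
      rw [SimpleGraph.mem_edgeFinset]
      exact SimpleGraph.Walk.edges_subset_edgeSet _ (List.mem_toFinset.1 he)
    refine hC _ hmem (Finset.disjoint_left.2 fun e heC he => ?_)
    rw [List.mem_toFinset, SimpleGraph.Walk.edges_mapLe_eq_edges] at he
    have := SimpleGraph.Walk.edges_subset_edgeSet _ he
    rw [SimpleGraph.edgeSet_deleteEdges] at this
    exact this.2 heC
  have h1 := hac.card_edgeFinset_le
  have h2 : G.edgeFinset.card ≤ (G.deleteEdges (C : Set (Sym2 V))).edgeFinset.card + C.card := by
    rw [SimpleGraph.edgeFinset_deleteEdges]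
    have := Finset.le_card_sdiff C G.edgeFinset
    omega
  have h3 : G.edgeFinset.card ≤ Fintype.card V + C.card := by omega
  calc G.edgeFinset.card * t ≤ (Fintype.card V + C.card) * t := Nat.mul_le_mul_right _ h3
    _ ≤ _ := by rw [add_mul]; omega

theorem bddAbove_edgeSet_ncard (n : ℕ) :
    BddAbove {m : ℕ | ∃ G : SimpleGraph (Fin n), DistinctCycleLengths G ∧
      G.edgeSet.ncard = m} := by
  refine ⟨Nat.card (Sym2 (Fin n)), ?_⟩
  rintro m ⟨G, -, rfl⟩
  rw [← Set.ncard_univ]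
  exact Set.ncard_le_ncard (Set.subset_univ _)

theorem maxEdges_le {n : ℕ} (hn : 0 < n) : (maxEdges n : ℝ) ≤ n + 18 * Real.sqrt n := by
  classical
  have : NeZero n := ⟨hn.ne'⟩
  have hmem := Nat.sSup_mem (s := {m : ℕ | ∃ G : SimpleGraph (Fin n), DistinctCycleLengths G ∧
      G.edgeSet.ncard = m}) ⟨_, ⊥, by
        intro u v c _ hc
        exact (SimpleGraph.isAcyclic_bot c hc).elim, rfl⟩ (bddAbove_edgeSet_ncard n)
  obtain ⟨G, hG, hGm⟩ := hmem
  change _ = maxEdges n at hGm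
  have hm : G.edgeFinset.card = maxEdges n := by
    rw [← hGm, ← SimpleGraph.coe_edgeFinset, Set.ncard_coe_finset]
  have key := hG.card_edgeFinset_mul_le (Nat.sqrt (maxEdges n) + 1)
  rw [hm, Fintype.card_fin] at key
  generalize maxEdges n = m at *
  have h1 : m ≤ n + 3 * (Nat.sqrt m + 1) := by
    have h := (Nat.sqrt_lt'.1 (Nat.lt_succ_self (Nat.sqrt m))).le
    rw [Nat.succ_eq_add_one] at h
    generalize Nat.sqrt m + 1 = s at *
    rcases Nat.eq_zero_or_pos s with hs | hs
    · subst hs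
      simp at h
      omega
    · refine Nat.le_of_mul_le_mul_right (c := s) ?_ hs
      nlinarith
  have h2 : (m : ℝ) ≤ n + 3 * (Real.sqrt m + 1) := by
    have h3 : (m : ℝ) ≤ n + 3 * ((Nat.sqrt m : ℝ) + 1) := by exact_mod_cast h1
    have := Real.nat_sqrt_le_real_sqrt (a := m)
    linarith
  have hn1 : (1 : ℝ) ≤ n := by exact_mod_cast hn
  have hs1 : 1 ≤ Real.sqrt n := Real.one_le_sqrt.2 hn1
  have hsm := Real.sq_sqrt (Nat.cast_nonneg (α := ℝ) m)
  have h4 : Real.sqrt m ≤ 5 * Real.sqrt n := by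
    rw [show (5 : ℝ) * Real.sqrt n = Real.sqrt (25 * n) by
      rw [Real.sqrt_mul (by norm_num), show (25 : ℝ) = 5 ^ 2 by norm_num,
        Real.sqrt_sq (by norm_num)]]
    apply Real.sqrt_le_sqrt
    nlinarith [sq_nonneg (Real.sqrt m - 3)]
  linarith

namespace SimpleGraph

variable {V : Type*} {G F : SimpleGraph V} {x : V}

theorem Walk.mem_edgeSet_of_notMem_support (hGF : ∀ a b, G.Adj a b → a ≠ x → b ≠ x → F.Adj a b)
    {u v : V} (p : G.Walk u v) (hp : x ∉ p.support) : ∀ e ∈ p.edges, e ∈ F.edgeSet := by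
  intro e he
  induction e using Sym2.ind with
  | _ a b =>
    refine hGF a b (p.adj_of_mem_edges he) ?_ ?_
    · rintro rfl
      exact hp (p.fst_mem_support_of_mem_edges he)
    · rintro rfl
      exact hp (p.snd_mem_support_of_mem_edges he)

theorem Walk.IsCycle.exists_path_of_hub [DecidableEq V] (hF : F.IsAcyclic)
    (hGF : ∀ a b, G.Adj a b → a ≠ x → b ≠ x → F.Adj a b) {u : V} {c : G.Walk u u}
    (hc : c.IsCycle) :
    ∃ (a b : V) (q : F.Walk a b), q.IsPath ∧ G.Adj x a ∧ G.Adj x b ∧ a ≠ b ∧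
      c.length = q.length + 2 ∧
      ∀ e, e ∈ c.edges ↔ e = s(x, a) ∨ e = s(x, b) ∨ e ∈ q.edges := by
  by_cases hx : x ∈ c.support
  · have hrot := hc.rotate hx
    have hedges : ∀ e, e ∈ c.edges ↔ e ∈ (c.rotate x hx).edges := fun e =>
      (c.rotate_edges x hx).perm.mem_iff.symm
    have hlen : c.length = (c.rotate x hx).length := by
      rw [← Walk.length_edges, ← Walk.length_edges]
      exact (c.rotate_edges x hx).perm.length_eq.symm
    simp only [hedges, hlen]
    generalize c.rotate x hx = c' at hrot
    cases c' with
    | nil => exact (hrot.ne_nil rfl).elim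
    | @cons _ a _ h p =>
      rw [Walk.cons_isCycle_iff] at hrot
      obtain ⟨hp, hxa⟩ := hrot
      have hp' := hp.reverse
      have hedges' : ∀ e, e ∈ p.edges ↔ e ∈ p.reverse.edges := by simp
      have hlen' : p.length = p.reverse.length := by simp
      simp only [Walk.edges_cons, List.mem_cons, Walk.length_cons, hedges', hlen'] at hxa ⊢
      generalize p.reverse = p' at hp' hxa
      cases p' with
      | nil => exact (G.irrefl h).elim
      | @cons _ b _ h' r =>
        rw [Walk.cons_isPath_iff] at hp'
        have hr := r.mem_edgeSet_of_notMem_support hGF hp'.2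
        refine ⟨b, a, r.transfer F hr, hp'.1.transfer hr, h', h, ?_, by simp, ?_⟩
        · rintro rfl
          simp at hxa
        · intro e
          simp only [Walk.edges_cons, List.mem_cons, Walk.edges_transfer]
          tauto
  · have h := c.mem_edgeSet_of_notMem_support hGF hx
    exact (hF _ (hc.transfer h)).elim

theorem distinctCycleLengths_of_hub (hF : F.IsAcyclic)
    (hGF : ∀ a b, G.Adj a b → a ≠ x → b ≠ x → F.Adj a b)
    (H : ∀ ⦃a b a' b' : V⦄ (q : F.Walk a b) (q' : F.Walk a' b'), q.IsPath → q'.IsPath →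
      G.Adj x a → G.Adj x b → G.Adj x a' → G.Adj x b' → a ≠ b → a' ≠ b' →
      q.length = q'.length → (a = a' ∧ b = b') ∨ (a = b' ∧ b = a')) :
    DistinctCycleLengths G := by
  classical
  intro u v c d hc hd hcd
  obtain ⟨a, b, q, hq, ha, hb, hab, hlen, he⟩ := hc.exists_path_of_hub hF hGF
  obtain ⟨a', b', q', hq', ha', hb', hab', hlen', he'⟩ := hd.exists_path_of_hub hF hGF
  ext e
  simp only [Set.mem_ofPred_eq, he, he']
  rcases H q q' hq hq' ha hb ha' hb' hab hab' (by omega) with ⟨rfl, rfl⟩ | ⟨rfl, rfl⟩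
  · have : q = q' := congrArg Subtype.val ((hF.subsingleton_path a b).elim ⟨q, hq⟩ ⟨q', hq'⟩)
    rw [this]
  · have : q = q'.reverse :=
      congrArg Subtype.val ((hF.subsingleton_path a b).elim ⟨q, hq⟩ ⟨q'.reverse, hq'.reverse⟩)
    rw [this, Walk.edges_reverse, List.mem_reverse]
    tauto

theorem isAcyclic_of_grading (φ : V → ℕ) (hne : ∀ a b, F.Adj a b → φ a ≠ φ b)
    (huniq : ∀ a b c, F.Adj a b → F.Adj a c → φ a < φ b → φ a < φ c → b = c) : F.IsAcyclic := by
  classical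
  intro u c hc
  obtain ⟨v, hv, hmin⟩ := Finset.exists_min_image c.support.toFinset φ ⟨u, by simp⟩
  rw [List.mem_toFinset] at hv
  have hrot := hc.rotate hv
  have hlt : ∀ w ∈ (c.rotate v hv).support, F.Adj v w → φ v < φ w := fun w hw h =>
    lt_of_le_of_ne (hmin w (by
      rw [List.mem_toFinset]
      exact (c.mem_support_rotate_iff v hv).1 hw)) (hne v w h)
  have hn := hrot.not_nil
  have h1 := (c.rotate v hv).adj_snd hn
  have h2 := (c.rotate v hv).adj_penultimate hn
  exact hrot.snd_ne_penultimate (huniq v _ _ h1 h2.symm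
    (hlt _ (Walk.getVert_mem_support _ _) h1) (hlt _ (Walk.getVert_mem_support _ _) h2.symm))

end SimpleGraph

/-- Vertices of a disjoint union of caterpillar-like trees indexed by `T`, together with a hub
and with an unlimited supply of pendant vertices. -/
inductive CaterpillarVertex (T : Type*) where
  | hub : CaterpillarVertex T
  | pad (q : ℕ) : CaterpillarVertex T
  | node (τ : T) (j p : ℕ) : CaterpillarVertex T

/-- The branch reached from height `p` of branch `j` by going up one step, when branch `j` merges
into branch `j + 1` at height `Z (j + 1)`. -/
def climb (Z : ℕ → ℕ) (j p : ℕ) : ℕ := if p + 1 < Z (j + 1) then j else j + 1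

namespace CaterpillarVertex

open SimpleGraph

variable {T : Type*}

/-- The forest in which the branch `j` of the tree `τ` joins branch `j + 1` at height
`Z τ (j + 1)`. -/
def forest (Z : T → ℕ → ℕ) : SimpleGraph (CaterpillarVertex T) :=
  SimpleGraph.fromRel fun v w => ∃ τ j p, v = node τ j p ∧ w = node τ (climb (Z τ) j p) (p + 1)

/-- The vertices joined to the hub: the pendant vertices and the vertex of height `Y τ j` on
each of the branches `j ≤ κ τ` of the tree `τ`. -/
def IsMarked (κ : T → ℕ) (Y : T → ℕ → ℕ) (v : CaterpillarVertex T) : Prop :=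
  (∃ q, v = pad q) ∨ ∃ τ j, j ≤ κ τ ∧ v = node τ j (Y τ j)

/-- The forest with all the marked vertices joined to the hub. -/
def hubGraph (κ : T → ℕ) (Y Z : T → ℕ → ℕ) : SimpleGraph (CaterpillarVertex T) :=
  forest Z ⊔ SimpleGraph.fromRel fun v w => v = hub ∧ IsMarked κ Y w

variable {κ : T → ℕ} {Y Z : T → ℕ → ℕ}

theorem forest_adj_up (τ : T) (j p : ℕ) :
    (forest Z).Adj (node τ j p) (node τ (climb (Z τ) j p) (p + 1)) := by
  rw [forest, SimpleGraph.fromRel_adj]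
  exact ⟨by simp, Or.inl ⟨τ, j, p, rfl, rfl⟩⟩

theorem forest_adj_iff {v w : CaterpillarVertex T} : (forest Z).Adj v w ↔
    ∃ τ j p, (v = node τ j p ∧ w = node τ (climb (Z τ) j p) (p + 1)) ∨
      (w = node τ j p ∧ v = node τ (climb (Z τ) j p) (p + 1)) := by
  constructor
  · rw [forest, SimpleGraph.fromRel_adj]
    rintro ⟨-, ⟨τ, j, p, h⟩ | ⟨τ, j, p, h⟩⟩
    · exact ⟨τ, j, p, Or.inl h⟩
    · exact ⟨τ, j, p, Or.inr h⟩
  · rintro ⟨τ, j, p, ⟨rfl, rfl⟩ | ⟨rfl, rfl⟩⟩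
    · exact forest_adj_up τ j p
    · exact (forest_adj_up τ j p).symm

theorem forest_isAcyclic : (forest Z).IsAcyclic := by
  refine isAcyclic_of_grading (fun v => match v with | node _ _ p => p | _ => 0) ?_ ?_
  · intro a b hab
    obtain ⟨τ, j, p, ⟨rfl, rfl⟩ | ⟨rfl, rfl⟩⟩ := forest_adj_iff.1 hab <;> simp
  · intro a b c hab hac
    obtain ⟨τ, j, p, ⟨rfl, rfl⟩ | ⟨rfl, rfl⟩⟩ := forest_adj_iff.1 hab
    · obtain ⟨τ', j', p', ⟨h, rfl⟩ | ⟨rfl, h⟩⟩ := forest_adj_iff.1 hac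
      · simp only [node.injEq] at h
        obtain ⟨rfl, rfl, rfl⟩ := h
        simp
      · simp only [node.injEq] at h
        obtain ⟨rfl, rfl, rfl⟩ := h
        simp only
        omega
    · simp only
      omega

theorem hubGraph_adj_hub {v : CaterpillarVertex T} :
    (hubGraph κ Y Z).Adj hub v ↔ IsMarked κ Y v := by
  rw [hubGraph, SimpleGraph.sup_adj, SimpleGraph.fromRel_adj, forest_adj_iff]
  constructor
  · rintro (⟨τ, j, p, ⟨h, -⟩ | ⟨-, h⟩⟩ | ⟨-, ⟨-, h⟩ | ⟨-, h⟩⟩)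
    · simp at h
    · simp at h
    · exact h
    · rcases h with ⟨q, h⟩ | ⟨τ, j, -, h⟩ <;> simp at h
  · intro h
    refine Or.inr ⟨?_, Or.inl ⟨rfl, h⟩⟩
    rintro rfl
    rcases h with ⟨q, h⟩ | ⟨τ, j, -, h⟩ <;> simp at h

theorem forest_adj_of_hubGraph_adj {v w : CaterpillarVertex T} (h : (hubGraph κ Y Z).Adj v w)
    (hv : v ≠ hub) (hw : w ≠ hub) : (forest Z).Adj v w := by
  rw [hubGraph, SimpleGraph.sup_adj, SimpleGraph.fromRel_adj] at h
  tauto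

/-- The tree containing a vertex. -/
def tree : CaterpillarVertex T → Option T
  | node τ _ _ => some τ
  | _ => none

theorem tree_eq_of_walk {v w : CaterpillarVertex T} (p : (forest Z).Walk v w) :
    v.tree = w.tree := by
  induction p with
  | nil => rfl
  | cons h _ ih =>
    rw [← ih]
    obtain ⟨τ, j, p, ⟨rfl, rfl⟩ | ⟨rfl, rfl⟩⟩ := forest_adj_iff.1 h <;> rfl

theorem pad_eq_of_walk {q : ℕ} {w : CaterpillarVertex T} (p : (forest Z).Walk (pad q) w) :
    w = pad q := by
  cases p with
  | nil => rfl
  | cons h _ => obtain ⟨τ, j, p, ⟨h, -⟩ | ⟨-, h⟩⟩ := forest_adj_iff.1 h <;> simp at h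

theorem exists_walk_branch (τ : T) (j p d : ℕ) (h : p + d < Z τ (j + 1)) :
    ∃ q : (forest Z).Walk (node τ j p) (node τ j (p + d)), q.length = d := by
  induction d with
  | zero => exact ⟨Walk.nil, rfl⟩
  | succ d ih =>
    obtain ⟨q, hq⟩ := ih (by omega)
    have hadj := forest_adj_up (Z := Z) τ j (p + d)
    rw [climb, if_pos (by omega)] at hadj
    exact ⟨q.concat hadj, by rw [Walk.length_concat, hq]⟩

theorem exists_walk_merge (τ : T) (j p : ℕ) (h : p < Z τ (j + 1)) :
    ∃ q : (forest Z).Walk (node τ j p) (node τ (j + 1) (Z τ (j + 1))),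
      q.length + p = Z τ (j + 1) := by
  obtain ⟨d, hd⟩ := Nat.exists_eq_add_of_lt h
  obtain ⟨q, hq⟩ := exists_walk_branch (Z := Z) τ j p d (by omega)
  have hadj := forest_adj_up (Z := Z) τ j (p + d)
  rw [climb, if_neg (by omega), ← hd] at hadj
  exact ⟨q.concat hadj, by rw [Walk.length_concat, hq]; omega⟩

theorem exists_walk_up (τ : T) (i d p : ℕ) (hp : p < Z τ (i + 1))
    (hZ : ∀ l, i < l → l < i + 1 + d → Z τ l < Z τ (l + 1)) :
    ∃ q : (forest Z).Walk (node τ i p) (node τ (i + 1 + d) (Z τ (i + 1 + d))),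
      q.length + p = Z τ (i + 1 + d) := by
  induction d with
  | zero => exact exists_walk_merge τ i p hp
  | succ d ih =>
    obtain ⟨q, hq⟩ := ih fun l h1 h2 => hZ l h1 (by omega)
    obtain ⟨r, hr⟩ := exists_walk_merge (Z := Z) τ (i + 1 + d) (Z τ (i + 1 + d))
      (hZ _ (by omega) (by omega))
    exact ⟨q.append r, by rw [Walk.length_append]; change _ = Z τ (i + 1 + d + 1); omega⟩

/-- The height of a vertex, with the part of branch `j` of the tree `τ` lying below the junction
at height `Z τ j` reflected upwards. -/
noncomputable def reflectedHeight (Z : T → ℕ → ℕ) (τ : T) (j : ℕ) : CaterpillarVertex T → ℤ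
  | node τ' l p => open Classical in
      if τ' = τ ∧ l = j ∧ p < Z τ j then 2 * (Z τ j : ℤ) - p else p
  | _ => 0

theorem reflectedHeight_sub_le_one {τ : T} {j : ℕ} (hZ : Z τ j < Z τ (j + 1))
    {v w : CaterpillarVertex T} (h : (forest Z).Adj v w) :
    reflectedHeight Z τ j w - reflectedHeight Z τ j v ≤ 1 := by
  have key : ∀ (τ' : T) (l p : ℕ),
      |reflectedHeight Z τ j (node τ' (climb (Z τ') l p) (p + 1)) -
        reflectedHeight Z τ j (node τ' l p)| ≤ 1 := by
    intro τ' l p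
    simp only [reflectedHeight, climb]
    rw [abs_le]
    by_cases hτ : τ' = τ
    · subst hτ
      by_cases hl : l = j
      · subst hl
        simp only [true_and]
        split_ifs <;> push_cast <;> omega
      · by_cases hl' : l + 1 = j
        · subst hl'
          simp only [true_and]
          split_ifs <;> push_cast <;> omega
        · simp only [true_and]
          split_ifs <;> push_cast <;> omega
    · simp [hτ]
  obtain ⟨τ', l, p, ⟨rfl, rfl⟩ | ⟨rfl, rfl⟩⟩ := forest_adj_iff.1 h
  · exact (abs_le.1 (key τ' l p)).2
  · have := (abs_le.1 (key τ' l p)).1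
    linarith

theorem reflectedHeight_le_of_walk {τ : T} {j : ℕ} (hZ : Z τ j < Z τ (j + 1))
    {v w : CaterpillarVertex T} (q : (forest Z).Walk v w) :
    reflectedHeight Z τ j w - reflectedHeight Z τ j v ≤ q.length := by
  induction q with
  | nil => simp
  | cons h _ ih =>
    have := reflectedHeight_sub_le_one hZ h
    rw [Walk.length_cons]
    push_cast
    linarith

theorem length_of_isPath {τ : T} {i j : ℕ} (hij : i < j) (hYi : Y τ i < Z τ (i + 1))
    (hYj : Y τ j ≤ Z τ j) (hZ : ∀ l, i < l → l ≤ j → Z τ l < Z τ (l + 1))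
    (q : (forest Z).Walk (node τ i (Y τ i)) (node τ j (Y τ j))) (hq : q.IsPath) :
    q.length + Y τ i + Y τ j = 2 * Z τ j := by
  classical
  have hlow := reflectedHeight_le_of_walk (hZ j hij le_rfl) q
  have hi : reflectedHeight Z τ j (node τ i (Y τ i)) = Y τ i := by
    simp [reflectedHeight, hij.ne]
  have hj : reflectedHeight Z τ j (node τ j (Y τ j)) = 2 * Z τ j - Y τ j := by
    simp only [reflectedHeight, true_and]
    split_ifs <;> omega
  rw [hi, hj] at hlow
  obtain ⟨d, rfl⟩ := Nat.exists_eq_add_of_le (show i + 1 ≤ j from hij)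
  obtain ⟨r, hr⟩ := exists_walk_up (Z := Z) τ i d (Y τ i) hYi fun l h1 h2 => hZ l h1 h2.le
  obtain ⟨s, hs⟩ := Nat.exists_eq_add_of_le hYj
  have hdown := exists_walk_branch (Z := Z) τ (i + 1 + d) (Y τ (i + 1 + d)) s
    (by rw [← hs]; exact hZ _ hij le_rfl)
  rw [← hs] at hdown
  obtain ⟨r', hr'⟩ := hdown
  have hpath : q = (r.append r'.reverse).bypass :=
    congrArg Subtype.val (((forest_isAcyclic (Z := Z)).subsingleton_path _ _).elim
      ⟨q, hq⟩ ⟨_, (r.append r'.reverse).bypass_isPath⟩)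
  have hup := (r.append r'.reverse).length_bypass_le_length
  rw [← hpath, Walk.length_append, Walk.length_reverse] at hup
  omega

/-- Conditions under which the cycles of `hubGraph κ Y Z` have distinct lengths. -/
structure IsAdmissible (κ : T → ℕ) (Y Z : T → ℕ → ℕ) : Prop where
  lt_succ : ∀ τ j, j ≤ κ τ → Y τ j < Z τ (j + 1)
  le : ∀ τ j, 0 < j → j ≤ κ τ → Y τ j ≤ Z τ j
  strict : ∀ τ j, 0 < j → j ≤ κ τ → Z τ j < Z τ (j + 1)
  inj : ∀ τ i j τ' i' j', i < j → j ≤ κ τ → i' < j' → j' ≤ κ τ' →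
    2 * Z τ j + Y τ' j' + Y τ' i' = 2 * Z τ' j' + Y τ j + Y τ i → τ = τ' ∧ i = i' ∧ j = j'

theorem exists_indices_of_isPath (h : IsAdmissible κ Y Z) {a b : CaterpillarVertex T}
    (q : (forest Z).Walk a b) (hq : q.IsPath) (ha : IsMarked κ Y a) (hb : IsMarked κ Y b)
    (hab : a ≠ b) : ∃ τ i j, i < j ∧ j ≤ κ τ ∧ q.length + Y τ i + Y τ j = 2 * Z τ j ∧
      ((a = node τ i (Y τ i) ∧ b = node τ j (Y τ j)) ∨
        (b = node τ i (Y τ i) ∧ a = node τ j (Y τ j))) := by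
  rcases ha with ⟨s, rfl⟩ | ⟨τ, i, hi, rfl⟩
  · exact (hab (pad_eq_of_walk q).symm).elim
  rcases hb with ⟨s, rfl⟩ | ⟨τ', j, hj, rfl⟩
  · exact (hab (pad_eq_of_walk q.reverse)).elim
  obtain rfl : τ = τ' := by simpa [tree] using tree_eq_of_walk q
  rcases lt_trichotomy i j with hij | rfl | hij
  · exact ⟨τ, i, j, hij, hj, length_of_isPath hij (h.lt_succ τ i hi) (h.le τ j (by omega) hj)
      (fun l h1 h2 => h.strict τ l (by omega) (by omega)) q hq, Or.inl ⟨rfl, rfl⟩⟩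
  · exact (hab rfl).elim
  · refine ⟨τ, j, i, hij, hi, ?_, Or.inr ⟨rfl, rfl⟩⟩
    rw [← Walk.length_reverse]
    exact length_of_isPath hij (h.lt_succ τ j hj) (h.le τ i (by omega) hi)
      (fun l h1 h2 => h.strict τ l (by omega) (by omega)) q.reverse hq.reverse

theorem distinctCycleLengths_hubGraph (h : IsAdmissible κ Y Z) :
    DistinctCycleLengths (hubGraph κ Y Z) := by
  refine distinctCycleLengths_of_hub (x := hub) forest_isAcyclic
    (fun a b => forest_adj_of_hubGraph_adj) ?_
  intro a b a' b' q q' hq hq' ha hb ha' hb' hab hab' hlen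
  rw [hubGraph_adj_hub] at ha hb ha' hb'
  obtain ⟨τ, i, j, hij, hj, hl, hc⟩ := exists_indices_of_isPath h q hq ha hb hab
  obtain ⟨τ', i', j', hij', hj', hl', hc'⟩ := exists_indices_of_isPath h q' hq' ha' hb' hab'
  obtain ⟨rfl, rfl, rfl⟩ := h.inj τ i j τ' i' j' hij hj hij' hj' (by omega)
  rcases hc with ⟨rfl, rfl⟩ | ⟨rfl, rfl⟩ <;> rcases hc' with ⟨rfl, rfl⟩ | ⟨rfl, rfl⟩ <;> simp

end CaterpillarVertex

theorem DistinctCycleLengths.comap {V W : Type*} {G : SimpleGraph V} (hG : DistinctCycleLengths G)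
    (f : W → V) (hf : Function.Injective f) : DistinctCycleLengths (G.comap f) := by
  intro u v c d hc hd hcd
  let φ : G.comap f →g G := ⟨f, fun h => h⟩
  have h := hG (c.map φ) (d.map φ) ((SimpleGraph.Walk.isCycle_map_iff_of_injective hf).2 hc)
    ((SimpleGraph.Walk.isCycle_map_iff_of_injective hf).2 hd) (by simpa using hcd)
  ext e
  have he := Set.ext_iff.1 h (e.map f)
  have hmap : Function.Injective (Sym2.map f) := Sym2.map.injective hf
  simp only [Set.mem_ofPred_eq, SimpleGraph.Walk.edges_map] at he ⊢
  exact (List.mem_map_of_injective hmap).symm.trans (he.trans (List.mem_map_of_injective hmap))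

theorem DistinctCycleLengths.card_le_maxEdges {V : Type*} [Infinite V] {G : SimpleGraph V}
    (hG : DistinctCycleLengths G) {n : ℕ} {S : Finset V} (hS : S.card ≤ n) {E : Finset (Sym2 V)}
    (hE : ∀ e ∈ E, e ∈ G.edgeSet) (hES : ∀ e ∈ E, ∀ v ∈ e, v ∈ S) : E.card ≤ maxEdges n := by
  classical
  obtain ⟨S', hSS', hS'⟩ := Infinite.exists_superset_card_eq S n hS
  let g := (S'.equivFinOfCardEq hS').symm
  let f : Fin n → V := fun i => (g i : V)
  have hf : Function.Injective f := fun i j h => g.injective (Subtype.ext h)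
  have hfS : ∀ v ∈ S, ∃ i, f i = v := fun v hv =>
    ⟨g.symm ⟨v, hSS' hv⟩, by simp [f]⟩
  refine le_trans ?_ (le_csSup (bddAbove_edgeSet_ncard n) ⟨G.comap f, hG.comap f hf, rfl⟩)
  rw [← Set.ncard_coe_finset]
  refine le_trans (Set.ncard_le_ncard (t := Sym2.map f '' (G.comap f).edgeSet) ?_)
    (Set.ncard_image_le (Set.toFinite _))
  intro e he
  have h1 := hE e he
  have h2 := hES e he
  induction e using Sym2.ind with
  | _ a b =>
    obtain ⟨i, rfl⟩ := hfS a (h2 a (by simp))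
    obtain ⟨j, rfl⟩ := hfS b (h2 b (by simp))
    exact ⟨s(i, j), h1, by simp⟩

namespace CaterpillarVertex

variable {T : Type*} {κ : T → ℕ} {Y Z : T → ℕ → ℕ}

instance : Infinite (CaterpillarVertex T) :=
  Infinite.of_injective pad fun _ _ h => by simpa using h

theorem add_sum_le_maxEdges [Fintype T] (h : IsAdmissible κ Y Z) {n : ℕ}
    (hn : 1 + Fintype.card T + ∑ τ, ∑ j ∈ Finset.range (κ τ + 1), (Z τ (j + 1) - Y τ j) ≤ n) :
    n + ∑ τ, κ τ ≤ maxEdges n + 1 := by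
  classical
  let M : Finset (Σ _ : T, ℕ) := Finset.univ.sigma fun τ => Finset.range (κ τ + 1)
  let P : Finset (Σ _ : Σ _ : T, ℕ, ℕ) := M.sigma fun x => Finset.Ico (Y x.1 x.2) (Z x.1 (x.2 + 1))
  have hM : M.card = ∑ τ, κ τ + Fintype.card T := by
    simp [M, Finset.card_sigma, Finset.sum_add_distrib]
  have hP : P.card = ∑ τ, ∑ j ∈ Finset.range (κ τ + 1), (Z τ (j + 1) - Y τ j) := by
    simp only [P, M, Finset.card_sigma, Nat.card_Ico, Finset.sum_sigma]
  rw [← hP] at hn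
  obtain ⟨r, rfl⟩ := Nat.exists_eq_add_of_le hn
  let I := P.disjSum (M.disjSum (Finset.range r))
  let g : (Σ _ : Σ _ : T, ℕ, ℕ) ⊕ (Σ _ : T, ℕ) ⊕ ℕ → Sym2 (CaterpillarVertex T) := fun
    | .inl x => s(node x.1.1 x.1.2 x.2, node x.1.1 (climb (Z x.1.1) x.1.2 x.2) (x.2 + 1))
    | .inr (.inl x) => s(hub, node x.1 x.2 (Y x.1 x.2))
    | .inr (.inr q) => s(hub, pad q)
  have hg : Function.Injective g := by
    rintro (⟨⟨τ, j⟩, p⟩ | ⟨τ, j⟩ | q) (⟨⟨τ', j'⟩, p'⟩ | ⟨τ', j'⟩ | q') hgg <;>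
      simp [g] at hgg ⊢
    · rcases hgg with ⟨h1, -⟩ | ⟨h1, h2⟩
      · simp [h1]
      · omega
    · simp [hgg]
    · exact hgg
  let S : Finset (CaterpillarVertex T) := {hub} ∪ Finset.univ.image
    (fun τ => node τ (κ τ + 1) (Z τ (κ τ + 1))) ∪ P.image (fun x => node x.1.1 x.1.2 x.2) ∪
    (Finset.range r).image pad
  have hnode : ∀ τ j p, j ≤ κ τ → Y τ j ≤ p → p < Z τ (j + 1) → node τ j p ∈ S := by
    intro τ j p h1 h2 h3
    have : (⟨⟨τ, j⟩, p⟩ : Σ _ : Σ _ : T, ℕ, ℕ) ∈ P := by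
      simp [P, M]
      omega
    have := Finset.mem_image_of_mem (fun x : Σ _ : Σ _ : T, ℕ, ℕ => node x.1.1 x.1.2 x.2) this
    simp only [S, Finset.mem_union]
    exact Or.inl (Or.inr this)
  have hroot : ∀ τ, node τ (κ τ + 1) (Z τ (κ τ + 1)) ∈ S := fun τ => by
    simp only [S, Finset.mem_union]
    exact Or.inl (Or.inl (Or.inr (Finset.mem_image_of_mem _ (Finset.mem_univ τ))))
  have hhub : hub ∈ S := by simp [S]
  have hcard := (distinctCycleLengths_hubGraph h).card_le_maxEdges (S := S)
    (n := 1 + Fintype.card T + P.card + r) (E := I.image g) ?_ ?_ ?_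
  · rw [Finset.card_image_of_injective _ hg, Finset.card_disjSum, Finset.card_disjSum, hM,
      Finset.card_range] at hcard
    omega
  · refine (Finset.card_union_le _ _).trans (add_le_add ((Finset.card_union_le _ _).trans
      (add_le_add ((Finset.card_union_le _ _).trans (add_le_add ?_ ?_)) ?_)) ?_)
    · simp
    · exact Finset.card_image_le
    · exact Finset.card_image_le
    · exact Finset.card_image_le.trans (by simp)
  · intro e he
    obtain ⟨i, hi, rfl⟩ := Finset.mem_image.1 he
    rcases i with ⟨⟨τ, j⟩, p⟩ | ⟨τ, j⟩ | q
    · exact Or.inl (forest_adj_up τ j p)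
    · refine hubGraph_adj_hub.2 (Or.inr ⟨τ, j, ?_, rfl⟩)
      simp [I, M] at hi
      omega
    · exact hubGraph_adj_hub.2 (Or.inl ⟨q, rfl⟩)
  · intro e he v hv
    obtain ⟨i, hi, rfl⟩ := Finset.mem_image.1 he
    rcases i with ⟨⟨τ, j⟩, p⟩ | ⟨τ, j⟩ | q
    · have hi' : j ≤ κ τ ∧ Y τ j ≤ p ∧ p < Z τ (j + 1) := by
        simp [I, P, M] at hi
        omega
      obtain ⟨h1, h2, h3⟩ := hi'
      rcases Sym2.mem_iff.1 hv with rfl | rfl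
      · exact hnode τ j p h1 h2 h3
      · simp only [climb]
        split_ifs with h4
        · exact hnode τ j (p + 1) h1 (by omega) h4
        · have h5 : p + 1 = Z τ (j + 1) := by omega
          rw [h5]
          rcases h1.lt_or_eq with h6 | rfl
          · exact hnode τ (j + 1) _ h6 (h.le τ (j + 1) (by omega) h6)
              (h.strict τ (j + 1) (by omega) h6)
          · exact hroot τ
    · have h1 : j ≤ κ τ := by
        simp [I, M] at hi
        omega
      rcases Sym2.mem_iff.1 hv with rfl | rfl
      · exact hhub
      · exact hnode τ j _ h1 le_rfl (h.lt_succ τ j h1)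
    · rcases Sym2.mem_iff.1 hv with rfl | rfl
      · exact hhub
      · simp [I] at hi
        simp [S, hi]

end CaterpillarVertex

namespace BlockConstruction

/-- Half of the modulus governing the cycle lengths in a block. -/
def halfModulus (k M : ℕ) : ℕ := (M + 1) * (M + 2 ^ (k + 1))

/-- The binary digit of `y` read on branch `j`. -/
def bit (k j y : ℕ) : ℕ := y / 2 ^ (k + 1 - j) % 2

/-- Height of the marked vertex on branch `j` of a block. -/
def blockMark (k M y e j : ℕ) : ℕ :=
  (2 * j * k + 2) * halfModulus k M - (2 * ((M + 1) * e * 2 ^ (k + 1 - j)) + bit k j y)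

/-- Height of the junction of branches `j - 1` and `j` of a block. -/
def blockJunction (k M y e r j : ℕ) : ℕ :=
  (k + 3 + j * (2 * k + 1)) * halfModulus k M + (M + 1) * y + r - (M + 1) * e * 2 ^ (k + 1 - j)

/-- The length, up to an additive constant, of the cycle of a block using branches `i < j`. -/
def blockLength (k M y e r i j : ℕ) : ℕ :=
  2 * halfModulus k M * ((k + 1) * (1 + (j - i)) + i) +
    (2 * ((M + 1) * (y + e * 2 ^ (k + 1 - i)) + r) + bit k i y + bit k j y)

variable {k M y e r : ℕ}

theorem bit_lt_two (k j y : ℕ) : bit k j y < 2 := Nat.mod_lt _ two_pos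

theorem shift_le (he : e < 2) (j : ℕ) :
    (M + 1) * e * 2 ^ (k + 1 - j) + M * (M + 1) ≤ halfModulus k M := by
  have h1 : 2 ^ (k + 1 - j) ≤ 2 ^ (k + 1) := Nat.pow_le_pow_right two_pos (by omega)
  have h2 : e * 2 ^ (k + 1 - j) ≤ 1 * 2 ^ (k + 1) := Nat.mul_le_mul (by omega) h1
  rw [halfModulus]
  nlinarith

theorem blockMark_add (hM : 0 < M) (he : e < 2) (j : ℕ) :
    blockMark k M y e j + (2 * ((M + 1) * e * 2 ^ (k + 1 - j)) + bit k j y) =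
      (2 * j * k + 2) * halfModulus k M := by
  rw [blockMark]
  apply Nat.sub_add_cancel
  have h1 := shift_le (k := k) (M := M) he j
  have h2 := bit_lt_two k j y
  nlinarith [Nat.zero_le (2 * j * k * halfModulus k M)]

theorem blockJunction_add (he : e < 2) (j : ℕ) :
    blockJunction k M y e r j + (M + 1) * e * 2 ^ (k + 1 - j) =
      (k + 3 + j * (2 * k + 1)) * halfModulus k M + (M + 1) * y + r := by
  rw [blockJunction]
  apply Nat.sub_add_cancel
  have h1 := shift_le (k := k) (M := M) he j
  nlinarith [Nat.zero_le ((k + j * (2 * k + 1)) * halfModulus k M)]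

theorem two_mul_blockJunction (hM : 0 < M) (he : e < 2) {i j : ℕ} (hij : i < j) :
    2 * blockJunction k M y e r j =
      blockMark k M y e j + blockMark k M y e i + blockLength k M y e r i j := by
  have h1 := blockMark_add (k := k) (y := y) hM he j
  have h2 := blockMark_add (k := k) (y := y) hM he i
  have h3 := blockJunction_add (k := k) (M := M) (y := y) (r := r) he j
  obtain ⟨d, rfl⟩ := Nat.exists_eq_add_of_lt hij
  rw [blockLength, show i + d + 1 - i = d + 1 by omega]
  linear_combination 2 * h3 - h1 - h2

theorem encode_add_two_le (hy : y < M) (hr : r < M) : (M + 1) * y + r + 2 ≤ M * (M + 1) := by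
  obtain ⟨d, rfl⟩ := Nat.exists_eq_add_of_lt hy
  nlinarith

theorem blockRemainder_lt (hy : y < M) (he : e < 2) (hr : r < M) (i j : ℕ) :
    2 * ((M + 1) * (y + e * 2 ^ (k + 1 - i)) + r) + bit k i y + bit k j y <
      2 * halfModulus k M := by
  have h1 := shift_le (k := k) (M := M) he i
  have h2 := bit_lt_two k i y
  have h3 := bit_lt_two k j y
  have h4 := encode_add_two_le hy hr
  nlinarith

theorem bit_add_self (i : ℕ) : bit k i (y + 2 ^ (k + 1 - i)) = (bit k i y + 1) % 2 := by
  rw [bit, bit, Nat.add_div_right _ (by positivity)]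
  omega

theorem bit_add_of_lt {i j : ℕ} (hij : i < j) (hj : j ≤ k + 1) :
    bit k j (y + 2 ^ (k + 1 - i)) = bit k j y := by
  have h : 2 ^ (k + 1 - i) = 2 ^ (k + 1 - j) * (2 * 2 ^ (j - i - 1)) := by
    rw [← pow_succ', ← pow_add]
    congr 1
    omega
  rw [bit, bit, h, Nat.add_mul_div_left _ _ (by positivity)]
  omega

theorem eq_of_blockRemainder_eq {i j y' e' r' : ℕ} (he : e < 2) (hr : r < M)
    (he' : e' < 2) (hr' : r' < M) (hij : i < j) (hj : j ≤ k + 1)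
    (h : 2 * ((M + 1) * (y + e * 2 ^ (k + 1 - i)) + r) + bit k i y + bit k j y =
      2 * ((M + 1) * (y' + e' * 2 ^ (k + 1 - i)) + r') + bit k i y' + bit k j y') :
    y = y' ∧ e = e' ∧ r = r' := by
  have b1 := bit_lt_two k i y
  have b2 := bit_lt_two k j y
  have b3 := bit_lt_two k i y'
  have b4 := bit_lt_two k j y'
  have hz : y + e * 2 ^ (k + 1 - i) = y' + e' * 2 ^ (k + 1 - i) := by
    generalize y + e * 2 ^ (k + 1 - i) = z at *
    generalize y' + e' * 2 ^ (k + 1 - i) = z' at *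
    have key : ∀ s, s < M + 1 → ((M + 1) * z + s) / (M + 1) = z := fun s hs => by
      rw [Nat.mul_add_div (by omega), Nat.div_eq_of_lt hs, add_zero]
    have key' : ∀ s, s < M + 1 → ((M + 1) * z' + s) / (M + 1) = z' := fun s hs => by
      rw [Nat.mul_add_div (by omega), Nat.div_eq_of_lt hs, add_zero]
    rw [← key (r + (bit k i y + bit k j y) / 2) (by omega),
      ← key' (r' + (bit k i y' + bit k j y') / 2) (by omega)]
    congr 1
    omega
  rw [hz] at h
  have hcases : (e = 0 ∧ e' = 0) ∨ (e = 0 ∧ e' = 1) ∨ (e = 1 ∧ e' = 0) ∨ (e = 1 ∧ e' = 1) := by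
    omega
  rcases hcases with ⟨rfl, rfl⟩ | ⟨rfl, rfl⟩ | ⟨rfl, rfl⟩ | ⟨rfl, rfl⟩
  · obtain rfl : y = y' := by simpa using hz
    exact ⟨rfl, rfl, by omega⟩
  · obtain rfl : y = y' + 2 ^ (k + 1 - i) := by simpa using hz
    rw [bit_add_self, bit_add_of_lt hij hj] at h
    omega
  · obtain rfl : y + 2 ^ (k + 1 - i) = y' := by simpa using hz
    rw [bit_add_self, bit_add_of_lt hij hj] at h
    omega
  · obtain rfl : y = y' := by simpa using hz
    exact ⟨rfl, rfl, by omega⟩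

theorem eq_and_eq_of_mul_add_eq {W q f q' f' : ℕ} (hf : f < W) (hf' : f' < W)
    (h : W * q + f = W * q' + f') : q = q' ∧ f = f' := by
  have hW : 0 < W := by omega
  have h1 := congrArg (· / W) h
  simp only [Nat.mul_add_div hW, Nat.div_eq_of_lt hf, Nat.div_eq_of_lt hf', add_zero] at h1
  subst h1
  exact ⟨rfl, by omega⟩

theorem eq_of_blockLength_eq {i j y' e' r' i' j' : ℕ} (hy : y < M) (he : e < 2) (hr : r < M)
    (hy' : y' < M) (he' : e' < 2) (hr' : r' < M) (hij : i < j) (hj : j ≤ k + 1)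
    (hij' : i' < j') (hj' : j' ≤ k + 1)
    (h : blockLength k M y e r i j = blockLength k M y' e' r' i' j') :
    y = y' ∧ e = e' ∧ r = r' ∧ i = i' ∧ j = j' := by
  obtain ⟨h1, h2⟩ := eq_and_eq_of_mul_add_eq (blockRemainder_lt hy he hr i j)
    (blockRemainder_lt hy' he' hr' i' j') h
  obtain ⟨h3, rfl⟩ := eq_and_eq_of_mul_add_eq (by omega) (by omega) h1
  obtain rfl : j = j' := by omega
  obtain ⟨rfl, rfl, rfl⟩ := eq_of_blockRemainder_eq he hr he' hr' hij hj h2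
  exact ⟨rfl, rfl, rfl, rfl, rfl⟩

theorem le_blockLength {i j : ℕ} (hij : i < j) :
    4 * (k + 1) * halfModulus k M ≤ blockLength k M y e r i j := by
  have h : 2 * (k + 1) ≤ (k + 1) * (1 + (j - i)) + i := by
    have : (k + 1) * 2 ≤ (k + 1) * (1 + (j - i)) := Nat.mul_le_mul_left _ (by omega)
    omega
  have := Nat.mul_le_mul_left (2 * halfModulus k M) h
  rw [blockLength]
  calc _ = 2 * halfModulus k M * (2 * (k + 1)) := by ring
    _ ≤ _ := by omega

theorem blockMark_lt_blockJunction_succ (hM : 0 < M) (he : e < 2) (j : ℕ) :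
    blockMark k M y e j < blockJunction k M y e r (j + 1) := by
  have h1 := blockMark_add (k := k) (y := y) hM he j
  have h2 := blockJunction_add (k := k) (M := M) (y := y) (r := r) he (j + 1)
  have h3 := shift_le (k := k) (M := M) he (j + 1)
  have h4 : 0 < halfModulus k M := by
    rw [halfModulus]
    positivity
  generalize halfModulus k M = H at *
  linarith [Nat.zero_le (j * H), Nat.zero_le (k * H), Nat.zero_le ((M + 1) * y),
    Nat.zero_le (M * (M + 1)), Nat.zero_le ((M + 1) * e * 2 ^ (k + 1 - j)),
    Nat.zero_le (bit k j y)]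

theorem blockMark_le_blockJunction (hM : 0 < M) (he : e < 2) (j : ℕ) :
    blockMark k M y e j ≤ blockJunction k M y e r j := by
  have h1 := blockMark_add (k := k) (y := y) hM he j
  have h2 := blockJunction_add (k := k) (M := M) (y := y) (r := r) he j
  have h3 := shift_le (k := k) (M := M) he j
  generalize halfModulus k M = H at *
  linarith [Nat.zero_le (j * H), Nat.zero_le (k * H), Nat.zero_le ((M + 1) * y),
    Nat.zero_le (M * (M + 1)), Nat.zero_le ((M + 1) * e * 2 ^ (k + 1 - j)),
    Nat.zero_le (bit k j y)]

theorem blockJunction_lt_succ (hk : 0 < k) (he : e < 2) (j : ℕ) :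
    blockJunction k M y e r j < blockJunction k M y e r (j + 1) := by
  have h1 := blockJunction_add (k := k) (M := M) (y := y) (r := r) he j
  have h2 := blockJunction_add (k := k) (M := M) (y := y) (r := r) he (j + 1)
  have h3 := shift_le (k := k) (M := M) he (j + 1)
  have h4 : 0 < halfModulus k M := by
    rw [halfModulus]
    positivity
  generalize halfModulus k M = H at *
  linarith [Nat.mul_le_mul_right H hk, Nat.zero_le ((M + 1) * e * 2 ^ (k + 1 - j)),
    Nat.zero_le (M * (M + 1))]

theorem blockJunction_succ_sub_le (hM : 0 < M) (hy : y < M) (he : e < 2) (hr : r < M) (j : ℕ) :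
    blockJunction k M y e r (j + 1) - blockMark k M y e j ≤
      (3 * k + 5 + j) * halfModulus k M := by
  have h1 := blockMark_add (k := k) (y := y) hM he j
  have h2 := blockJunction_add (k := k) (M := M) (y := y) (r := r) he (j + 1)
  have h3 := shift_le (k := k) (M := M) he j
  have h4 := encode_add_two_le hy hr
  have h5 := bit_lt_two k j y
  rw [Nat.sub_le_iff_le_add]
  generalize halfModulus k M = H at *
  linarith [Nat.zero_le (M * (M + 1)), Nat.zero_le ((M + 1) * e * 2 ^ (k + 1 - (j + 1)))]

end BlockConstruction

namespace BlockConstruction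

open CaterpillarVertex

/-- The trees of the construction: one for each short cycle length, and the blocks. -/
abbrev Index (k M : ℕ) : Type :=
  Fin (4 * (k + 1) * halfModulus k M - 1) ⊕ (Fin M × Fin 2 × Fin M)

/-- The index of the last marked branch of each tree. -/
def lastBranch (k M : ℕ) : Index k M → ℕ
  | .inl _ => 1
  | .inr _ => k + 1

/-- The heights of the marked vertices. -/
def mark (k M : ℕ) : Index k M → ℕ → ℕ
  | .inl a, j => if j = 0 then 0 else a + 1
  | .inr (y, e, _), j => blockMark k M y e j

/-- The heights of the junctions. -/
def junction (k M : ℕ) : Index k M → ℕ → ℕ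
  | .inl a, j => a + j
  | .inr (y, e, r), j => blockJunction k M y e r j

/-- The cycle lengths, up to an additive constant. -/
def cycleLength (k M : ℕ) : Index k M → ℕ → ℕ → ℕ
  | .inl a, _, _ => a + 1
  | .inr (y, e, r), i, j => blockLength k M y e r i j

variable {k M : ℕ}

theorem halfModulus_pos : 0 < halfModulus k M := by
  rw [halfModulus]
  positivity

theorem two_mul_junction (hM : 0 < M) (τ : Index k M) {i j : ℕ} (hij : i < j)
    (hj : j ≤ lastBranch k M τ) : 2 * junction k M τ j =
      mark k M τ j + mark k M τ i + cycleLength k M τ i j := by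
  rcases τ with a | ⟨y, e, r⟩
  · simp only [lastBranch] at hj
    obtain rfl : j = 1 := by omega
    obtain rfl : i = 0 := by omega
    simp [junction, mark, cycleLength]
    omega
  · exact two_mul_blockJunction hM e.2 hij

theorem cycleLength_inj {τ τ' : Index k M} {i j i' j' : ℕ} (hij : i < j)
    (hj : j ≤ lastBranch k M τ) (hij' : i' < j') (hj' : j' ≤ lastBranch k M τ')
    (h : cycleLength k M τ i j = cycleLength k M τ' i' j') : τ = τ' ∧ i = i' ∧ j = j' := by
  rcases τ with a | ⟨y, e, r⟩ <;> rcases τ' with a' | ⟨y', e', r'⟩ <;>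
    simp only [cycleLength, lastBranch] at h hj hj'
  · refine ⟨?_, by omega, by omega⟩
    congr 1
    ext
    omega
  · have := le_blockLength (k := k) (M := M) (y := y') (e := e') (r := r') hij'
    have := a.2
    omega
  · have := le_blockLength (k := k) (M := M) (y := y) (e := e) (r := r) hij
    have := a'.2
    omega
  · obtain ⟨h1, h2, h3, h4⟩ := eq_of_blockLength_eq y.2 e.2 r.2 y'.2 e'.2 r'.2 hij hj hij' hj' h
    refine ⟨?_, h4⟩
    rw [Fin.ext h1, Fin.ext h2, Fin.ext h3]

theorem isAdmissible (hk : 0 < k) (hM : 0 < M) :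
    IsAdmissible (lastBranch k M) (mark k M) (junction k M) where
  lt_succ τ j hj := by
    rcases τ with a | ⟨y, e, r⟩
    · simp only [mark, junction]
      split_ifs <;> omega
    · exact blockMark_lt_blockJunction_succ hM e.2 j
  le τ j h0 hj := by
    rcases τ with a | ⟨y, e, r⟩
    · simp only [mark, junction]
      split_ifs <;> omega
    · exact blockMark_le_blockJunction hM e.2 j
  strict τ j h0 hj := by
    rcases τ with a | ⟨y, e, r⟩
    · simp only [junction]
      omega
    · exact blockJunction_lt_succ hk e.2 j
  inj τ i j τ' i' j' hij hj hij' hj' h := by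
    have h1 := two_mul_junction hM τ hij hj
    have h2 := two_mul_junction hM τ' hij' hj'
    exact cycleLength_inj hij hj hij' hj' (by omega)

theorem two_mul_sum_block_le (hM : 0 < M) (y : Fin M) (e : Fin 2) (r : Fin M) :
    2 * ∑ j ∈ Finset.range (k + 1 + 1),
      (blockJunction k M y e r (j + 1) - blockMark k M y e j) ≤
        (k + 2) * (7 * k + 11) * halfModulus k M := by
  have h : ∑ j ∈ Finset.range (k + 1 + 1),
      (blockJunction k M y e r (j + 1) - blockMark k M y e j) ≤
        ∑ j ∈ Finset.range (k + 1 + 1), (3 * k + 5 + j) * halfModulus k M :=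
    Finset.sum_le_sum fun j _ => blockJunction_succ_sub_le hM y.2 e.2 r.2 j
  rw [← Finset.sum_mul, Finset.sum_add_distrib, Finset.sum_const, Finset.card_range] at h
  have h2 := Finset.sum_range_id_mul_two (k + 1 + 1)
  rw [Nat.add_sub_cancel] at h2
  simp only [smul_eq_mul] at h
  generalize ∑ j ∈ Finset.range (k + 1 + 1), j = s at *
  calc _ ≤ (2 * ((k + 1 + 1) * (3 * k + 5)) + s * 2) * halfModulus k M := by linarith
    _ = _ := by rw [h2]; ring

theorem two_mul_sum_single (A : ℕ) :
    2 * ∑ a : Fin A, ∑ j ∈ Finset.range (1 + 1),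
      ((a : ℕ) + (j + 1) - if j = 0 then 0 else (a : ℕ) + 1) = A * (A + 3) := by
  have h : ∀ a : Fin A, ∑ j ∈ Finset.range (1 + 1),
      ((a : ℕ) + (j + 1) - if j = 0 then 0 else (a : ℕ) + 1) = a + 2 := fun a => by
    rw [Finset.sum_range_succ, Finset.sum_range_one]
    simp
  rw [Finset.sum_congr rfl fun a _ => h a, Fin.sum_univ_eq_sum_range (fun a => a + 2) A]
  induction A with
  | zero => simp
  | succ A ih =>
    rw [Finset.sum_range_succ, mul_add, ih]
    · ring
    · intro a
      rw [Finset.sum_range_succ, Finset.sum_range_one]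
      simp

theorem add_le_maxEdges (hk : 0 < k) (hM : 0 < M) {n : ℕ}
    (hn : 15 * ((k + 2) * halfModulus k M) ^ 2 ≤ n) :
    n + (4 * (k + 1) * halfModulus k M + 2 * (k + 1) * M ^ 2) ≤ maxEdges n + 2 := by
  have hH : 0 < halfModulus k M := halfModulus_pos
  have hMH : M ^ 2 ≤ halfModulus k M := by
    rw [halfModulus]
    nlinarith [Nat.zero_le (2 ^ (k + 1) * (M + 1))]
  have hsum := two_mul_sum_single (4 * (k + 1) * halfModulus k M - 1)
  have hblock : 2 * ∑ x : Fin M × Fin 2 × Fin M, ∑ j ∈ Finset.range (k + 1 + 1),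
      (blockJunction k M x.1 x.2.1 x.2.2 (j + 1) - blockMark k M x.1 x.2.1 j) ≤
      2 * M ^ 2 * ((k + 2) * (7 * k + 11) * halfModulus k M) := by
    rw [Finset.mul_sum]
    refine (Finset.sum_le_sum fun x _ => two_mul_sum_block_le hM x.1 x.2.1 x.2.2).trans ?_
    simp only [Finset.sum_const, Finset.card_univ, Fintype.card_prod, Fintype.card_fin,
      smul_eq_mul]
    exact le_of_eq (by ring)
  have hblock' : 2 * M ^ 2 * ((k + 2) * (7 * k + 11) * halfModulus k M) ≤
      2 * halfModulus k M * ((k + 2) * (7 * k + 11) * halfModulus k M) := by gcongr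
  have hkH : k * k ≤ k * k * halfModulus k M := Nat.le_mul_of_pos_right _ hH
  have h := add_sum_le_maxEdges (isAdmissible hk hM) (n := n) (by
    rw [Fintype.sum_sum_type]
    simp only [lastBranch, mark, junction, Fintype.card_sum, Fintype.card_prod, Fintype.card_fin]
    obtain ⟨A, hA⟩ : ∃ A, 4 * (k + 1) * halfModulus k M = A + 1 :=
      Nat.exists_eq_add_one_of_ne_zero (by positivity)
    simp only [hA, Nat.add_sub_cancel] at hsum ⊢
    refine le_trans ?_ hn
    generalize halfModulus k M = H at *
    have h2 : A * (A + 3) + 2 * (A + 1) ≤ (A + 1) * (A + 1) + 3 * (A + 1) := by nlinarith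
    rw [← hA] at h2
    have h3 : H ≤ H * H := Nat.le_mul_of_pos_left _ hH
    have h4 : k * H ≤ k * (H * H) := Nat.mul_le_mul_left k h3
    nlinarith [Nat.zero_le (k * (H * H)), Nat.zero_le (k * k * (H * H))])
  simp only [Fintype.sum_sum_type, lastBranch, Finset.sum_const, Finset.card_univ,
    Fintype.card_prod, Fintype.card_fin, smul_eq_mul] at h
  have : M * (2 * M) * (k + 1) = 2 * (k + 1) * M ^ 2 := by ring
  have : 0 < 4 * (k + 1) * halfModulus k M := by positivity
  omega

end BlockConstruction

open Filter Topology in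
theorem eventually_le_excess {k : ℕ} (hk : 0 < k) {a : ℝ}
    (ha : a < 6 * (k + 1) / (Real.sqrt 15 * (k + 2))) :
    ∀ᶠ n : ℕ in atTop, a ≤ ((maxEdges n : ℝ) - (n : ℝ)) / Real.sqrt n := by
  set c : ℝ := Real.sqrt 15 * (k + 2) with hc
  have hc0 : 0 < c := by positivity
  let x : ℕ → ℝ := fun n => Real.sqrt (Real.sqrt n / c)
  let D : ℝ := 1 + 2 ^ (k + 1)
  have hx : Tendsto x atTop atTop :=
    Real.tendsto_sqrt_atTop.comp ((Real.tendsto_sqrt_atTop.comp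
      tendsto_natCast_atTop_atTop).atTop_div_const hc0)
  have hlim : Tendsto (fun n => 6 * (k + 1) / c - (12 * (k + 1) * D / c) * (x n)⁻¹ -
      (2 / c) * ((x n)⁻¹ * (x n)⁻¹)) atTop (𝓝 (6 * (k + 1) / c - (12 * (k + 1) * D / c) * 0 -
      (2 / c) * (0 * 0))) := by
    have hinv := tendsto_inv_atTop_zero.comp hx
    exact (tendsto_const_nhds.sub (hinv.const_mul _)).sub ((hinv.mul hinv).const_mul _)
  have hev := hlim.eventually_const_lt (u := a) (by simpa using ha)
  filter_upwards [hev, hx.eventually_ge_atTop (D + 1), eventually_gt_atTop 0] with n hn hxn hn0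
  have hsq : Real.sqrt n = c * x n ^ 2 := by
    rw [Real.sq_sqrt (by positivity)]
    field_simp
  have hD : (0 : ℝ) < D := by positivity
  have hx0 : 0 < x n := by linarith
  obtain ⟨M, hM⟩ : ∃ M : ℕ, Nat.floor (x n) = M + 2 ^ (k + 1) :=
    ⟨Nat.floor (x n) - 2 ^ (k + 1), (Nat.sub_add_cancel (Nat.le_floor (by
      push_cast
      linarith))).symm⟩
  have hM1 : (M : ℝ) + 2 ^ (k + 1) ≤ x n := by
    have := Nat.floor_le hx0.le
    rw [hM] at this
    exact_mod_cast this
  have hM2 : x n - D < M := by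
    have := Nat.lt_floor_add_one (x n)
    rw [hM] at this
    push_cast at this
    linarith
  have hM0 : 0 < M := by
    have : (0 : ℝ) < M := by linarith
    exact_mod_cast this
  have hmod : (BlockConstruction.halfModulus k M : ℝ) ≤ x n ^ 2 := by
    rw [BlockConstruction.halfModulus]
    push_cast
    have : (1 : ℝ) ≤ 2 ^ (k + 1) := one_le_pow₀ (by norm_num)
    nlinarith
  have hmod' : (M : ℝ) ^ 2 ≤ BlockConstruction.halfModulus k M := by
    rw [BlockConstruction.halfModulus]
    push_cast
    have : (0 : ℝ) ≤ 2 ^ (k + 1) := by positivity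
    nlinarith
  have hle := BlockConstruction.add_le_maxEdges hk hM0 (n := n) (by
    have h1 : (15 : ℝ) * ((k + 2) * BlockConstruction.halfModulus k M) ^ 2 ≤ n := by
      rw [← Real.sq_sqrt (Nat.cast_nonneg (α := ℝ) n), hsq, hc]
      calc (15 : ℝ) * ((k + 2) * BlockConstruction.halfModulus k M) ^ 2
          ≤ 15 * ((k + 2) * x n ^ 2) ^ 2 := by gcongr
        _ = Real.sqrt 15 ^ 2 * ((k + 2) * x n ^ 2) ^ 2 := by
          rw [Real.sq_sqrt (show (0 : ℝ) ≤ 15 by norm_num)]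
        _ = _ := by ring
    exact_mod_cast h1)
  have hle' : (n : ℝ) + (4 * (k + 1) * BlockConstruction.halfModulus k M +
      2 * (k + 1) * M ^ 2) ≤ maxEdges n + 2 := by exact_mod_cast hle
  have hfin : 6 * (k + 1) * (x n - D) ^ 2 - 2 ≤ (maxEdges n : ℝ) - n := by
    have h1 : (x n - D) ^ 2 ≤ (M : ℝ) ^ 2 := pow_le_pow_left₀ (by linarith) hM2.le 2
    have h2 : (4 * ((k : ℝ) + 1)) * M ^ 2 ≤
        4 * (k + 1) * BlockConstruction.halfModulus k M := by gcongr
    have h3 : (6 * ((k : ℝ) + 1)) * (x n - D) ^ 2 ≤ 6 * (k + 1) * M ^ 2 := by gcongr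
    linarith
  rw [hsq, le_div_iff₀ (by positivity)]
  refine le_trans ?_ hfin
  calc a * (c * x n ^ 2) ≤ (6 * (k + 1) / c - (12 * (k + 1) * D / c) * (x n)⁻¹ -
      (2 / c) * ((x n)⁻¹ * (x n)⁻¹)) * (c * x n ^ 2) := by gcongr
    _ = 6 * (k + 1) * (x n ^ 2 - 2 * D * x n) - 2 := by
      field_simp
      ring
    _ ≤ _ := by
      have : 0 ≤ 6 * ((k : ℝ) + 1) * D ^ 2 := by positivity
      linarith

open Filter Topology in
theorem tendsto_ratio : Tendsto (fun k : ℕ => 6 * ((k : ℝ) + 1) / (Real.sqrt 15 * (k + 2))) atTop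
    (𝓝 (Real.sqrt (12 / 5))) := by
  have hs : Real.sqrt (12 / 5) = 6 / Real.sqrt 15 := by
    rw [Real.sqrt_eq_iff_mul_self_eq (by norm_num) (by positivity), div_mul_div_comm,
      Real.mul_self_sqrt (by norm_num)]
    norm_num
  have h : Tendsto (fun k : ℕ => 6 / Real.sqrt 15 * (((k : ℝ) + 1) / (k + 2))) atTop
      (𝓝 (6 / Real.sqrt 15 * 1)) := by
    refine Tendsto.const_mul _ ?_
    have := tendsto_add_mul_div_add_mul_atTop_nhds (𝕜 := ℝ) 1 2 1 one_ne_zero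
    simpa [add_comm] using this
  rw [hs]
  refine (mul_one (6 / Real.sqrt 15) ▸ h).congr fun k => ?_
  field_simp

theorem stmt2 :
    Real.sqrt (12 / 5) ≤
      Filter.atTop.liminf (fun n : ℕ => ((maxEdges n : ℝ) - (n : ℝ)) / Real.sqrt n) := by
  have hbdd : Filter.atTop.IsCoboundedUnder (· ≥ ·)
      (fun n : ℕ => ((maxEdges n : ℝ) - (n : ℝ)) / Real.sqrt n) := by
    refine Filter.IsCoboundedUnder.of_frequently_le (a := 18) (Filter.Eventually.frequently ?_)
    filter_upwards [Filter.eventually_gt_atTop 0] with n hn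
    have := maxEdges_le hn
    rw [div_le_iff₀ (by positivity)]
    linarith
  refine le_of_tendsto tendsto_ratio ?_
  filter_upwards [Filter.eventually_gt_atTop 0] with k hk
  refine le_of_forall_lt fun a ha => ?_
  obtain ⟨b, hab, hb⟩ := exists_between ha
  exact hab.trans_le (Filter.le_liminf_of_le hbdd (eventually_le_excess hk hb))
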